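/- arXiv:1812.09433 — 7 statements merged into one kernel-verified Lean document; each statement's English description precedes it below -/
import Mathlib

section
/- Let c1, c2, c3 be strictly positive real numbers and let C = c1 + c2 + c3. Then 1 − π(c2/C) − π(c3/C) > 1 − π((c2+c3)/C). (Interpretation: under the first-is-root rescaling of the 1-Pachira lottree with first node u1 of contribution c1 and second node u2 of contribution c2, the lottery value of u1 is strictly larger when a new node u3 of contribution c3 joins as a child of u1, where it equals 1 − π(c2/C) − π(c3/C), than when u3 joins as a child of u2, where it equals 1 − π((c2+c3)/C); hence the first-is-root rescaling satisfies the continuing solicitation incentive.) -/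
/-- The Pachira weight function `π(c) = β·c + (1 − β)·c^(1+δ)` (real power). -/
noncomputable def pachira (β δ : ℝ) (c : ℝ) : ℝ := β * c + (1 - β) * c ^ (1 + δ)

/-- Real powers with exponent greater than one are strictly superadditive on positive reals. -/
theorem Real.rpow_one_add_add_rpow_one_add_lt {δ x y : ℝ} (hδ : 0 < δ) (hx : 0 < x)
    (hy : 0 < y) : x ^ (1 + δ) + y ^ (1 + δ) < (x + y) ^ (1 + δ) := by
  have hxy : 0 < x + y := add_pos hx hy
  rw [Real.rpow_one_add' hx.le (by positivity), Real.rpow_one_add' hy.le (by positivity),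
    Real.rpow_one_add' hxy.le (by positivity), add_mul]
  have hx' : x ^ δ < (x + y) ^ δ := Real.rpow_lt_rpow hx.le (by linarith) hδ
  have hy' : y ^ δ < (x + y) ^ δ := Real.rpow_lt_rpow hy.le (by linarith) hδ
  gcongr

/-- Under the first-is-root rescaling of the 1-Pachira lottree, the first node's
lottery value is strictly larger when the new node joins as its own child than
when it joins as a child of the second node (continuing solicitation incentive). -/
theorem firstIsRoot_CSI (β δ : ℝ) (hβ0 : 0 ≤ β) (hβ1 : β < 1) (hδ : 0 < δ)
    (c1 c2 c3 : ℝ) (h1 : 0 < c1) (h2 : 0 < c2) (h3 : 0 < c3) :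
    1 - pachira β δ (c2 / (c1 + c2 + c3)) - pachira β δ (c3 / (c1 + c2 + c3)) >
      1 - pachira β δ ((c2 + c3) / (c1 + c2 + c3)) := by
  have hC : 0 < c1 + c2 + c3 := by positivity
  have h := mul_lt_mul_of_pos_left
    (Real.rpow_one_add_add_rpow_one_add_lt hδ (div_pos h2 hC) (div_pos h3 hC))
    (sub_pos.mpr hβ1)
  rw [add_div]
  simp only [pachira]
  linarith
end

section
/- Let s be a finite index set and f : s → ℝ a family of nonnegative real numbers with ∑_{i∈s} f(i) ≤ 1, and suppose at least two indices i ≠ j in s satisfy f(i) > 0 and f(j) > 0. Then ∑_{i∈s} π(f(i)) < π(∑_{i∈s} f(i)). (Interpretation: splitting a contribution into two or more positive parts strictly decreases total Pachira weight, so a sybil attack by splitting into sibling replicas strictly decreases total lottery value.) -/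
/-- Real powers with exponent greater than one are strictly superadditive along finite sums with at
least two positive terms. -/
theorem sum_rpow_one_add_lt_rpow_sum {δ : ℝ} (hδ : 0 < δ) {ι : Type*} {s : Finset ι} {f : ι → ℝ}
    (hf : ∀ i ∈ s, 0 ≤ f i) {i j : ι} (hi : i ∈ s) (hj : j ∈ s) (hij : i ≠ j)
    (hfi : 0 < f i) (hfj : 0 < f j) :
    ∑ k ∈ s, f k ^ (1 + δ) < (∑ k ∈ s, f k) ^ (1 + δ) := by
  have hexp : 1 + δ ≠ 0 := by positivity
  have hlt : f i < ∑ k ∈ s, f k :=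
    Finset.single_lt_sum hij.symm hi hj hfj fun k hk _ => hf k hk
  rw [Real.rpow_one_add' (Finset.sum_nonneg hf) hexp, Finset.sum_mul]
  refine Finset.sum_lt_sum (fun k hk => ?_) ⟨i, hi, ?_⟩
  · rw [Real.rpow_one_add' (hf k hk) hexp]
    exact mul_le_mul_of_nonneg_left
      (Real.rpow_le_rpow (hf k hk) (Finset.single_le_sum hf hk) hδ.le) (hf k hk)
  · rw [Real.rpow_one_add' hfi.le hexp]
    exact mul_lt_mul_of_pos_left (Real.rpow_lt_rpow hfi.le hlt hδ) hfi

/-- Splitting a contribution into two or more positive parts strictly decreases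
total Pachira weight (a sybil attack by splitting into sibling replicas strictly
decreases total lottery value). -/
theorem pachira_sum_lt_of_two_pos (β δ : ℝ) (hβ0 : 0 ≤ β) (hβ1 : β < 1) (hδ : 0 < δ)
    {ι : Type*} (s : Finset ι) (f : ι → ℝ) (hf : ∀ i ∈ s, 0 ≤ f i)
    (hsum : ∑ i ∈ s, f i ≤ 1)
    (i j : ι) (hi : i ∈ s) (hj : j ∈ s) (hij : i ≠ j)
    (hfi : 0 < f i) (hfj : 0 < f j) :
    ∑ i ∈ s, pachira β δ (f i) < pachira β δ (∑ i ∈ s, f i) := by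
  simp only [pachira, Finset.sum_add_distrib, ← Finset.mul_sum]
  gcongr
  exact sum_rpow_one_add_lt_rpow_sum hδ hf hi hj hij hfi hfj
end

section
/- Let b_1, …, b_n be nonnegative real numbers and a a real number with ∑_{i=1}^n b_i ≤ a ≤ 1. Then π(a) − ∑_{i=1}^n π(b_i) ≥ β·(a − ∑_{i=1}^n b_i). (Interpretation: in a 1-Pachira lottree, a node u whose subtree has contribution fraction a and whose children's subtrees have contribution fractions b_1,…,b_n has lottery value L(u) = π(a) − ∑_i π(b_i) ≥ β·C(u)/C(T), i.e. the mechanism satisfies value proportional to contribution with coefficient β; in particular all lottery values are nonnegative.) -/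
/-- Superadditivity of `x ↦ x ^ p` for `1 ≤ p` over finite sums of nonnegative reals. -/
theorem Real.sum_rpow_le_rpow_sum_of_one_le {ι : Type*} (s : Finset ι) {f : ι → ℝ}
    (hf : ∀ i ∈ s, 0 ≤ f i) {p : ℝ} (hp : 1 ≤ p) :
    ∑ i ∈ s, f i ^ p ≤ (∑ i ∈ s, f i) ^ p := by
  have key : ∀ x : ℝ, 0 ≤ x → x ^ p = x * x ^ (p - 1) := fun x hx ↦ by
    rw [← Real.rpow_one_add' hx (by linarith), add_sub_cancel]
  rw [key _ (Finset.sum_nonneg hf), Finset.sum_mul]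
  refine Finset.sum_le_sum fun i hi ↦ ?_
  rw [key _ (hf i hi)]
  exact mul_le_mul_of_nonneg_left
    (Real.rpow_le_rpow (hf i hi) (Finset.single_le_sum hf hi) (by linarith)) (hf i hi)

/-- Value proportional to contribution: a node whose subtree has contribution
fraction `a` and whose children's subtrees have contribution fractions
`b 1, …, b n` has lottery value `π(a) − ∑ π(b i) ≥ β·(a − ∑ b i)`. -/
theorem pachira_VPC (β δ : ℝ) (hβ0 : 0 ≤ β) (hβ1 : β < 1) (hδ : 0 < δ)
    (n : ℕ) (b : Fin n → ℝ) (hb : ∀ i, 0 ≤ b i) (a : ℝ)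
    (hba : ∑ i, b i ≤ a) (ha : a ≤ 1) :
    pachira β δ a - ∑ i, pachira β δ (b i) ≥ β * (a - ∑ i, b i) := by
  have hsum : ∑ i, b i ^ (1 + δ) ≤ a ^ (1 + δ) :=
    (Real.sum_rpow_le_rpow_sum_of_one_le _ (fun i _ ↦ hb i) (by linarith)).trans
      (Real.rpow_le_rpow (Finset.sum_nonneg fun i _ ↦ hb i) hba (by linarith))
  have hmul := mul_le_mul_of_nonneg_left hsum (sub_nonneg.mpr hβ1.le)
  simp only [pachira, Finset.sum_add_distrib, ← Finset.mul_sum]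
  linarith
end

section
/- Let s > 0 be a real number and let d_1, …, d_k be nonnegative real numbers with D = ∑_{j=1}^k d_j. Then the function f : [0, ∞) → ℝ defined by f(c) = π((c + D)/(c + D + s)) − ∑_{j=1}^k π(d_j/(c + D + s)) is strictly increasing on [0, ∞). (Interpretation: in a 1-Pachira lottree, if a node's child subtrees have fixed contributions d_1,…,d_k and the total contribution outside its subtree is s > 0, then the node's lottery value strictly increases as its own contribution c increases; this is the continuing contribution incentive.) -/
/-- The Pachira weight function is strictly increasing on the nonnegative reals. -/
theorem pachira_strictMonoOn {β δ : ℝ} (hβ0 : 0 ≤ β) (hβ1 : β < 1) (hδ : 0 < δ) :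
    StrictMonoOn (pachira β δ) (Set.Ici 0) := by
  intro x hx y _ hxy
  have hpow : x ^ (1 + δ) < y ^ (1 + δ) := Real.rpow_lt_rpow hx hxy (by linarith)
  exact add_lt_add_of_le_of_lt (mul_le_mul_of_nonneg_left hxy.le hβ0)
    (mul_lt_mul_of_pos_left hpow (sub_pos.mpr hβ1))

/-- Continuing contribution incentive: if a node's child subtrees have fixed
contributions `d 1, …, d k` and the total contribution outside its subtree is
`s > 0`, then its lottery value strictly increases in its own contribution `c`. -/
theorem pachira_CCI (β δ : ℝ) (hβ0 : 0 ≤ β) (hβ1 : β < 1) (hδ : 0 < δ)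
    (s : ℝ) (hs : 0 < s) (k : ℕ) (d : Fin k → ℝ) (hd : ∀ j, 0 ≤ d j) :
    StrictMonoOn
      (fun c : ℝ =>
        pachira β δ ((c + ∑ j, d j) / (c + ∑ j, d j + s)) -
          ∑ j, pachira β δ (d j / (c + ∑ j, d j + s)))
      (Set.Ici (0 : ℝ)) := by
  intro a ha b _ hab
  have ha' : 0 ≤ a := ha
  have hD : 0 ≤ ∑ j, d j := Finset.sum_nonneg fun j _ => hd j
  have hπ := pachira_strictMonoOn hβ0 hβ1 hδ
  have hA : 0 < a + ∑ j, d j + s := by linarith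
  have hB : 0 < b + ∑ j, d j + s := by linarith
  refine (sub_lt_sub_right (hπ ?_ ?_ ?_) _).trans_le
    (sub_le_sub_left (Finset.sum_le_sum fun j _ => hπ.monotoneOn ?_ ?_ ?_) _)
  · exact div_nonneg (by linarith) hA.le
  · exact div_nonneg (by linarith) hB.le
  · rw [div_lt_div_iff₀ hA hB]
    linarith [mul_lt_mul_of_pos_right hab hs]
  · exact div_nonneg (hd j) hB.le
  · exact div_nonneg (hd j) hA.le
  · exact div_le_div_of_nonneg_left (hd j) hA (by linarith)
end

section
/- Let π(c) = c/2 + c^(27/25)/2 (the Pachira function with β = 1/2 and δ = 2/25), and set a = π(1/3) and b = π(2/3). For positive reals x, y, z with x + y + z = 1, define P(x, y, z) = z + x·z/(y + z) + y·z/(x + z), the probability that the node with lottery value z is selected when 2 winners are drawn in succession without replacement from three nodes with lottery values x, y, z. Then P(1 − 2a, a, a) > P(1 − b, b − a, a). (Interpretation: three participants each contribute 10; when the third joins as a child of the first-is-root node the lottery values are (1 − 2a, a, a), and when it joins as a child of the second node they are (1 − b, b − a, a); since its winning probability differs in the two cases, winner-selection Strategy A for the K-Pachira lottree with K = 2 violates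 unprofitable solicitor bypassing.) -/
/-- The Pachira weight function with `β = 1/2` and `δ = 2/25`:
`π(c) = c/2 + c^(27/25)/2` (real power). -/
noncomputable def pachiraHalf (c : ℝ) : ℝ := c / 2 + c ^ ((27 : ℝ) / 25) / 2

/-- `P x y z = z + x·z/(y+z) + y·z/(x+z)`: the probability that the node with
lottery value `z` is selected when 2 winners are drawn in succession without
replacement from three nodes with lottery values `x, y, z`. -/
noncomputable def winProb (x y z : ℝ) : ℝ := z + x * z / (y + z) + y * z / (x + z)

theorem pachiraHalf_eq {c : ℝ} (hc : 0 < c) :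
    pachiraHalf c = c * (1 + c ^ ((2 : ℝ) / 25)) / 2 := by
  have h : c ^ ((27 : ℝ) / 25) = c * c ^ ((2 : ℝ) / 25) := by
    rw [show (27 : ℝ) / 25 = 1 + 2 / 25 by norm_num, Real.rpow_add hc, Real.rpow_one]
  rw [pachiraHalf, h]
  ring

theorem pachiraHalf_pos {c : ℝ} (hc : 0 < c) : 0 < pachiraHalf c := by
  rw [pachiraHalf]
  positivity

theorem pachiraHalf_lt_self {c : ℝ} (hc : 0 < c) (hc1 : c < 1) : pachiraHalf c < c := by
  have h : c ^ ((2 : ℝ) / 25) < 1 := Real.rpow_lt_one hc.le hc1 (by norm_num)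
  rw [pachiraHalf_eq hc]
  nlinarith

theorem two_mul_pachiraHalf_lt {c : ℝ} (hc : 0 < c) :
    2 * pachiraHalf c < pachiraHalf (2 * c) := by
  have h : c ^ ((2 : ℝ) / 25) < (2 * c) ^ ((2 : ℝ) / 25) :=
    Real.rpow_lt_rpow hc.le (by linarith) (by norm_num)
  rw [pachiraHalf_eq hc, pachiraHalf_eq (by positivity)]
  nlinarith

/-- For lottery values summing to `1`, `winProb x y z` depends on `x` and `y` only through
the product `x * y`. -/
theorem winProb_eq {x y z : ℝ} (hx : 0 < x) (hy : 0 < y) (hz : 0 < z) (h : x + y + z = 1) :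
    winProb x y z = z * ((1 + z) / (z + x * y) - 1) := by
  have hprod : z + x * y = (y + z) * (x + z) := by
    linear_combination (-z) * h
  rw [hprod, winProb]
  have hyz : y + z ≠ 0 := by positivity
  have hxz : x + z ≠ 0 := by positivity
  field_simp
  obtain rfl : x = 1 - y - z := by linarith
  ring

theorem winProb_lt_winProb {x y x' y' z : ℝ} (hx : 0 < x) (hy : 0 < y) (hx' : 0 < x')
    (hy' : 0 < y') (hz : 0 < z) (h : x + y + z = 1) (h' : x' + y' + z = 1)
    (hlt : x' * y' < x * y) : winProb x y z < winProb x' y' z := by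
  rw [winProb_eq hx hy hz h, winProb_eq hx' hy' hz h']
  gcongr

/-- With `a = π(1/3)` and `b = π(2/3)`, the third node's winning probability under
Strategy A with `K = 2` is strictly larger when it joins as a child of the
first-is-root node (lottery values `(1 − 2a, a, a)`) than when it joins as a
child of the second node (lottery values `(1 − b, b − a, a)`): Strategy A
violates unprofitable solicitor bypassing. -/
theorem strategyA_violates_USB :
    winProb (1 - 2 * pachiraHalf (1 / 3)) (pachiraHalf (1 / 3)) (pachiraHalf (1 / 3)) >
      winProb (1 - pachiraHalf (2 / 3)) (pachiraHalf (2 / 3) - pachiraHalf (1 / 3))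
        (pachiraHalf (1 / 3)) := by
  have ha := pachiraHalf_pos (c := 1 / 3) (by norm_num)
  have ha' := pachiraHalf_lt_self (c := 1 / 3) (by norm_num) (by norm_num)
  have hb' := pachiraHalf_lt_self (c := 2 / 3) (by norm_num) (by norm_num)
  have hab := two_mul_pachiraHalf_lt (c := 1 / 3) (by norm_num)
  rw [show (2 : ℝ) * (1 / 3) = 2 / 3 by norm_num] at hab
  set a := pachiraHalf (1 / 3)
  set b := pachiraHalf (2 / 3)
  have hgap : 0 < (b - 2 * a) * (1 - a - b) := mul_pos (by linarith) (by linarith)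
  apply winProb_lt_winProb <;> linarith
end

section
/- Let α and γ be real numbers with 0 < γ < α. Then there exists p0 ∈ (0, 1) such that for every p ∈ (0, p0), p^γ / (p^γ + (1 − p)^γ)^(1/γ) > p^α. (Interpretation: with CPT value function ν(x) = x^α and weighting function ω⁺, for sufficiently small lottery values p the perceived reward B^α·ω⁺(p) of the 1-Pachira lottree exceeds the perceived reward (B·p)^α of the Sharing-Pachira lottree, so participants with low lottery values prefer the single-winner lottery.) -/
/-- With CPT value function `ν(x) = x^α` and weighting function
`ω⁺(p) = p^γ / (p^γ + (1 − p)^γ)^(1/γ)` where `0 < γ < α`, for all sufficiently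
small `p` one has `ω⁺(p) > p^α`: participants with low lottery values prefer the
single-winner lottery. -/
theorem cpt_small_prob_prefers_lottery (α γ : ℝ) (hγ : 0 < γ) (hγα : γ < α) :
    ∃ p0 ∈ Set.Ioo (0 : ℝ) 1, ∀ p ∈ Set.Ioo (0 : ℝ) p0,
      p ^ γ / (p ^ γ + (1 - p) ^ γ) ^ (1 / γ) > p ^ α := by
  have hδ : 0 < α - γ := sub_pos.2 hγα
  have h_lt_one : (2 : ℝ) ^ (-(1 / γ / (α - γ))) < 1 :=
    Real.rpow_lt_one_of_one_lt_of_neg one_lt_two (neg_lt_zero.2 (by positivity))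
  refine ⟨2 ^ (-(1 / γ / (α - γ))), ⟨by positivity, h_lt_one⟩, ?_⟩
  rintro p ⟨hp, hp_lt⟩
  have hq : 0 < 1 - p := by linarith
  have hsum : p ^ γ + (1 - p) ^ γ ≤ 2 := by
    linarith [Real.rpow_le_one hp.le (by linarith : p ≤ 1) hγ.le,
      Real.rpow_le_one hq.le (by linarith : 1 - p ≤ 1) hγ.le]
  have hden : (p ^ γ + (1 - p) ^ γ) ^ (1 / γ) ≤ 2 ^ (1 / γ) :=
    Real.rpow_le_rpow (by positivity) hsum (by positivity)
  have hpow : p ^ (α - γ) < (2 ^ (1 / γ))⁻¹ := by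
    calc p ^ (α - γ) < (2 ^ (-(1 / γ / (α - γ)))) ^ (α - γ) :=
          Real.rpow_lt_rpow hp.le hp_lt hδ
      _ = (2 ^ (1 / γ))⁻¹ := by
          rw [← Real.rpow_mul zero_le_two, neg_mul, div_mul_cancel₀ _ hδ.ne',
            Real.rpow_neg zero_le_two]
  calc p ^ α = p ^ γ * p ^ (α - γ) := by rw [← Real.rpow_add hp, add_sub_cancel]
    _ < p ^ γ * (2 ^ (1 / γ))⁻¹ := by gcongr
    _ = p ^ γ / 2 ^ (1 / γ) := (div_eq_mul_inv _ _).symm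
    _ ≤ p ^ γ / (p ^ γ + (1 - p) ^ γ) ^ (1 / γ) := by gcongr
end

section
/- Let α = 22/25 (= 0.88) and γ = 61/100 (= 0.61). Then there exists a critical value p* ∈ (0, 1) such that p*^γ / (p*^γ + (1 − p*)^γ)^(1/γ) = p*^α. (Interpretation: with the standard CPT parameters, there is a critical lottery value at which the perceived reward B^α·ω⁺(p) of the 1-Pachira lottree equals the perceived reward (B·p)^α of the Sharing-Pachira lottree; below it the 1-Pachira lottree is preferred and above it the Sharing-Pachira lottree is preferred.) -/
/-- With the standard CPT parameters `α = 0.88` and `γ = 0.61`, there is a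
critical lottery value `p* ∈ (0,1)` at which the perceived reward of the
1-Pachira lottree equals that of the Sharing-Pachira lottree:
`ω⁺(p*) = p*^α`. -/
theorem cpt_critical_value_exists :
    ∃ p ∈ Set.Ioo (0 : ℝ) 1,
      p ^ ((61 : ℝ) / 100) /
          (p ^ ((61 : ℝ) / 100) + (1 - p) ^ ((61 : ℝ) / 100)) ^ ((100 : ℝ) / 61)
        = p ^ ((22 : ℝ) / 25) := by
  have weight_pos : ∀ x ∈ Set.Ioo (0 : ℝ) 1,
      0 < x ^ ((61 : ℝ) / 100) + (1 - x) ^ ((61 : ℝ) / 100) := fun x hx =>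
    add_pos (Real.rpow_pos_of_pos hx.1 _) (Real.rpow_pos_of_pos (sub_pos.2 hx.2) _)
  have left_pos : (0 : ℝ) < 2 ^ (-20 : ℝ) := by positivity
  have left_le : (2 : ℝ) ^ (-20 : ℝ) ≤ 2 ^ (-1 : ℝ) :=
    Real.rpow_le_rpow_of_exponent_le one_le_two (by norm_num)
  have half_eq : (2 : ℝ) ^ (-1 : ℝ) = 1 / 2 := by rw [Real.rpow_neg_one]; norm_num
  have subset_Ioo : Set.Icc ((2 : ℝ) ^ (-20 : ℝ)) (2 ^ (-1 : ℝ)) ⊆ Set.Ioo 0 1 := fun x hx =>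
    ⟨left_pos.trans_le hx.1, hx.2.trans_lt (by rw [half_eq]; norm_num)⟩
  have left_mem := subset_Ioo (Set.left_mem_Icc.2 left_le)
  have continuousOn_power (r : ℝ) : ContinuousOn (fun x : ℝ => x ^ r) (Set.Ioo 0 1) :=
    continuousOn_id.rpow_const fun x hx => Or.inl hx.1.ne'
  have continuousOn_weight : ContinuousOn (fun x : ℝ => x ^ ((61 : ℝ) / 100) /
      (x ^ ((61 : ℝ) / 100) + (1 - x) ^ ((61 : ℝ) / 100)) ^ ((100 : ℝ) / 61))
      (Set.Ioo 0 1) := by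
    refine (continuousOn_power _).div (((continuousOn_power _).add
      ((continuousOn_const.sub continuousOn_id).rpow_const fun x hx =>
        Or.inl (sub_pos.2 hx.2).ne')).rpow_const fun x hx => Or.inl (weight_pos x hx).ne') ?_
    exact fun x hx => (Real.rpow_pos_of_pos (weight_pos x hx) _).ne'
  have le_left : ((2 : ℝ) ^ (-20 : ℝ)) ^ ((22 : ℝ) / 25) ≤
      ((2 : ℝ) ^ (-20 : ℝ)) ^ ((61 : ℝ) / 100) /
        (((2 : ℝ) ^ (-20 : ℝ)) ^ ((61 : ℝ) / 100) +
          (1 - (2 : ℝ) ^ (-20 : ℝ)) ^ ((61 : ℝ) / 100)) ^ ((100 : ℝ) / 61) := by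
    have hS : (((2 : ℝ) ^ (-20 : ℝ)) ^ ((61 : ℝ) / 100) +
        (1 - (2 : ℝ) ^ (-20 : ℝ)) ^ ((61 : ℝ) / 100)) ^ ((100 : ℝ) / 61) ≤
          2 ^ ((100 : ℝ) / 61) := by
      refine Real.rpow_le_rpow (weight_pos _ left_mem).le ?_ (by norm_num)
      have h₁ := Real.rpow_le_one left_mem.1.le left_mem.2.le
        (by norm_num : (0 : ℝ) ≤ 61 / 100)
      have h₂ := Real.rpow_le_one (sub_nonneg.2 left_mem.2.le) (sub_le_self 1 left_mem.1.le)
        (by norm_num : (0 : ℝ) ≤ 61 / 100)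
      linarith
    rw [le_div_iff₀ (Real.rpow_pos_of_pos (weight_pos _ left_mem) _)]
    refine (mul_le_mul_of_nonneg_left hS (by positivity)).trans ?_
    rw [← Real.rpow_mul zero_le_two, ← Real.rpow_mul zero_le_two, ← Real.rpow_add two_pos]
    exact Real.rpow_le_rpow_of_exponent_le one_le_two (by norm_num)
  have right_le : ((2 : ℝ) ^ (-1 : ℝ)) ^ ((61 : ℝ) / 100) /
        (((2 : ℝ) ^ (-1 : ℝ)) ^ ((61 : ℝ) / 100) +
          (1 - (2 : ℝ) ^ (-1 : ℝ)) ^ ((61 : ℝ) / 100)) ^ ((100 : ℝ) / 61) ≤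
      ((2 : ℝ) ^ (-1 : ℝ)) ^ ((22 : ℝ) / 25) := by
    have hsub : 1 - (2 : ℝ) ^ (-1 : ℝ) = 2 ^ (-1 : ℝ) := by rw [half_eq]; norm_num
    have hS : (2 : ℝ) ^ (-1 * (61 / 100) : ℝ) + 2 ^ (-1 * (61 / 100) : ℝ) =
        2 ^ ((39 : ℝ) / 100) := by
      rw [← two_mul, ← Real.rpow_one_add' zero_le_two (by norm_num)]
      norm_num
    rw [hsub, ← Real.rpow_mul zero_le_two, ← Real.rpow_mul zero_le_two, hS,
      ← Real.rpow_mul zero_le_two, ← Real.rpow_sub two_pos]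
    exact Real.rpow_le_rpow_of_exponent_le one_le_two (by norm_num)
  obtain ⟨p, hp, heq⟩ := isPreconnected_Icc.intermediate_value₂
    (Set.right_mem_Icc.2 left_le) (Set.left_mem_Icc.2 left_le)
    (continuousOn_weight.mono subset_Ioo) ((continuousOn_power (22 / 25)).mono subset_Ioo)
    right_le le_left
  exact ⟨p, subset_Ioo hp, heq⟩
end
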